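/- Let w₁, w₂ be nonzero complex numbers with w₁/w₂ ∉ ℝ and Γ = {n·w₁ + m·w₂ : n, m ∈ ℤ}. There is no function F : ℂ → ℂ such that: (i) F(z + w₁) = F(z) and F(z + w₂) = F(z) for all z; (ii) F is complex-differentiable at every point of ℂ \ Γ; and (iii) there exist c ∈ ℂ with c ≠ 0 and a function h holomorphic on a neighborhood of 0 such that F(z) = c/z + h(z) for all z ≠ 0 in that neighborhood (i.e. F has a simple pole with nonzero residue at each lattice point and no other singularities). In other words, there is no elliptic function of degree 1. -/

import Mathlib

/-- The lattice generated by `w₁` and `w₂`. -/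
def latticeSet (w₁ w₂ : ℂ) : Set ℂ := {z : ℂ | ∃ n m : ℤ, z = (n : ℂ) * w₁ + (m : ℂ) * w₂}

open Filter Topology

namespace PeriodPair

variable (L : PeriodPair)

/-- A function with periods `ω₁` and `ω₂` is invariant under translation by the lattice. -/
lemma periodic_of_mem_lattice {α : Type*} {f : ℂ → α} (h₁ : Function.Periodic f L.ω₁)
    (h₂ : Function.Periodic f L.ω₂) {l : ℂ} (hl : l ∈ L.lattice) : Function.Periodic f l := by
  obtain ⟨m, n, rfl⟩ := mem_lattice.mp hl
  exact (h₁.int_mul m).add_period (h₂.int_mul n)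

/-- Liouville's theorem for elliptic functions: a doubly periodic function, all of whose
singularities are removable, is constant up to a discrete set. -/
lemma exists_eventuallyEq_const {f : ℂ → ℂ} (hper : ∀ l ∈ L.lattice, Function.Periodic f l)
    (hf : ∀ z, ∃ g : ℂ → ℂ, AnalyticAt ℂ g z ∧ f =ᶠ[𝓝[≠] z] g) :
    ∃ K : ℂ, ∀ z, f =ᶠ[𝓝[≠] z] fun _ ↦ K := by
  choose g hg hfg using hf
  have hlim {z w : ℂ} (hw : ContinuousAt (g z) w) (h : f =ᶠ[𝓝[≠] w] g z) : g w w = g z w := by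
    refine tendsto_nhds_unique_of_eventuallyEq
      ((hg w).continuousAt.tendsto.mono_left nhdsWithin_le_nhds)
      (hw.tendsto.mono_left nhdsWithin_le_nhds) ((hfg w).symm.trans h)
  have hE (z : ℂ) : (fun w ↦ g w w) =ᶠ[𝓝 z] g z := by
    have h := eventually_eventually_nhdsWithin.mpr (hfg z)
    rw [eventually_nhdsWithin_iff] at h
    filter_upwards [h, (hg z).eventually_analyticAt] with w hw hgw
    rcases eq_or_ne w z with rfl | hne
    · rfl
    · refine hlim hgw.continuousAt ?_
      have := hw hne
      rw [nhdsWithin_eq_nhds.mpr (isOpen_compl_singleton.mem_nhds hne)] at this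
      exact this.filter_mono nhdsWithin_le_nhds
  have hdiff : Differentiable ℂ fun w ↦ g w w := fun z ↦
    ((hE z).differentiableAt_iff).mpr (hg z).differentiableAt
  have hperE : ∀ z l, l ∈ L.lattice → g (z + l) (z + l) = g z z := by
    intro z l hl
    have ht : Tendsto (fun w ↦ w + l) (𝓝[≠] z) (𝓝[≠] (z + l)) :=
      ((continuous_add_const l).tendsto z).inf
        (tendsto_principal_principal.mpr fun w hw ↦ by simpa using hw)
    refine tendsto_nhds_unique_of_eventuallyEq
      (((hg (z + l)).continuousAt.tendsto.mono_left nhdsWithin_le_nhds).comp ht)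
      ((hg z).continuousAt.tendsto.mono_left nhdsWithin_le_nhds) ?_
    filter_upwards [ht.eventually (hfg (z + l)), hfg z] with w hw hw'
    rw [Function.comp_apply, ← hw, ← hw', hper l hl]
  obtain ⟨K, hK⟩ := hdiff.exists_const_forall_eq_of_bounded
    (IsZLattice.isCompact_range_of_periodic L.lattice _ hdiff.continuous hperE).isBounded
  refine ⟨K, fun z ↦ (hfg z).trans ?_⟩
  filter_upwards [(hE z).filter_mono nhdsWithin_le_nhds] with w hw
  rw [← hw, hK]

lemma add_div_two_notMem_lattice : L.ω₁ / 2 + L.ω₂ / 2 ∉ L.lattice := by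
  simpa [inv_mul_eq_div] using
    (L.mul_ω₁_add_mul_ω₂_mem_lattice (α := 1 / 2) (β := 1 / 2)).not.mpr (by norm_num)

/-- There is no elliptic function whose only singularities are simple poles at the
lattice points. -/
lemma false_of_simple_pole {F : ℂ → ℂ} (hper : ∀ l ∈ L.lattice, Function.Periodic F l)
    (hF : ∀ z ∉ L.lattice, AnalyticAt ℂ F z) {c : ℂ} (hc : c ≠ 0) {h : ℂ → ℂ}
    (hh : AnalyticAt ℂ h 0) (hpole : ∀ᶠ z in 𝓝[≠] 0, F z = c / z + h z) : False := by
  have hpole' {l : ℂ} (hl : l ∈ L.lattice) :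
      ∀ᶠ z in 𝓝[≠] l, F z = c / (z - l) + h (z - l) := by
    have ht : Tendsto (fun w ↦ w - l) (𝓝[≠] l) (𝓝[≠] 0) :=
      ((continuous_sub_right l).tendsto' l 0 (sub_self l)).inf
        (tendsto_principal_principal.mpr fun w hw ↦ by simpa [sub_eq_zero] using hw)
    filter_upwards [ht.eventually hpole] with z hz
    rw [← hz, ← hper l hl (z - l), sub_add_cancel]
  -- `F z + F (-z)` is constant
  obtain ⟨K, hK⟩ : ∃ K, ∀ z, (fun z ↦ F z + F (-z)) =ᶠ[𝓝[≠] z] fun _ ↦ K := by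
    refine L.exists_eventuallyEq_const (fun l hl z ↦ ?_) fun z ↦ ?_
    · have := hper (-l) (neg_mem hl) (-z)
      simp only [hper l hl z, neg_add, this]
    · by_cases hz : z ∈ L.lattice
      · refine ⟨fun w ↦ h (w - z) + h (-(w - z)), .add ?_ ?_, ?_⟩
        · exact AnalyticAt.fun_comp (by simpa using hh) (by fun_prop)
        · exact AnalyticAt.fun_comp (by simpa using hh) (by fun_prop)
        · have ht : Tendsto (fun w : ℂ ↦ -w) (𝓝[≠] z) (𝓝[≠] (-z)) :=
            (continuous_neg.tendsto z).inf
              (tendsto_principal_principal.mpr fun w hw ↦ by simpa using hw)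
          filter_upwards [hpole' hz, ht.eventually (hpole' (neg_mem hz))] with w hw hw'
          rw [hw, hw', show -w - -z = -(w - z) by ring, div_neg]
          ring
      · exact ⟨_, (hF z hz).add ((hF (-z) (by simpa using hz)).fun_comp (by fun_prop)),
          .rfl⟩
  -- the half periods are zeros of `F - K / 2`
  have hhalf {l : ℂ} (hl : l ∈ L.lattice) (hl2 : l / 2 ∉ L.lattice) : F (l / 2) = K / 2 := by
    have hcont : ContinuousAt (fun z ↦ F z + F (-z)) (l / 2) :=
      (hF _ hl2).continuousAt.add
        ((hF _ (by simpa using hl2)).continuousAt.comp' continuous_neg.continuousAt)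
    have h₁ := tendsto_nhds_unique_of_eventuallyEq
      (hcont.tendsto.mono_left nhdsWithin_le_nhds) tendsto_const_nhds (hK (l / 2))
    have h₂ := hper l hl (-(l / 2))
    rw [show -(l / 2) + l = l / 2 by ring] at h₂
    simp only [← h₂] at h₁
    linear_combination h₁ / 2
  set G : ℂ → ℂ := fun z ↦ F z - K / 2 with hG
  have hGper : ∀ l ∈ L.lattice, Function.Periodic G l := fun l hl z ↦ by
    simp [hG, hper l hl z]
  have hGan : ∀ z ∉ L.lattice, AnalyticAt ℂ G z := fun z hz ↦ (hF z hz).sub analyticAt_const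
  have hGmul {l : ℂ} (hl : l ∈ L.lattice) :
      ∃ k : ℂ → ℂ, AnalyticAt ℂ k l ∧ k l = c ∧ ∀ᶠ z in 𝓝[≠] l, (z - l) * G z = k z := by
    refine ⟨fun z ↦ c + (z - l) * (h (z - l) - K / 2), ?_, by simp, ?_⟩
    · have : AnalyticAt ℂ (fun z ↦ h (z - l)) l :=
        AnalyticAt.fun_comp (by simpa using hh) (by fun_prop)
      exact analyticAt_const.add
        ((analyticAt_id.sub analyticAt_const).mul (this.sub analyticAt_const))
    · filter_upwards [hpole' hl, self_mem_nhdsWithin] with z hz hne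
      have : z - l ≠ 0 := sub_ne_zero.mpr hne
      simp only [hG, hz]
      field_simp
      ring
  have hG₁ : G (L.ω₁ / 2) = 0 :=
    sub_eq_zero.mpr (hhalf L.ω₁_mem_lattice L.ω₁_div_two_notMem_lattice)
  have hG₂ : G (L.ω₂ / 2) = 0 :=
    sub_eq_zero.mpr (hhalf L.ω₂_mem_lattice L.ω₂_div_two_notMem_lattice)
  -- `G z * G (z + ω₁ / 2)` is constant
  have hPper (z : ℂ) : G (z + L.ω₁ / 2 + L.ω₁ / 2) = G z := by
    rw [add_assoc, add_halves, hGper _ L.ω₁_mem_lattice]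
  have hcancel {l : ℂ} (hl : l ∈ L.lattice) :
      ∃ g : ℂ → ℂ, AnalyticAt ℂ g l ∧ (fun z ↦ G z * G (z + L.ω₁ / 2)) =ᶠ[𝓝[≠] l] g := by
    have hB : AnalyticAt ℂ (fun z ↦ G (z + L.ω₁ / 2)) l := by
      refine (hGan _ fun hmem ↦ L.ω₁_div_two_notMem_lattice ?_).fun_comp (by fun_prop)
      simpa using sub_mem hmem hl
    have hB0 : G (l + L.ω₁ / 2) = 0 := by rw [add_comm, hGper l hl, hG₁]
    obtain ⟨d, hd, hBd⟩ := (natCast_le_analyticOrderAt (n := 1) hB).mp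
      (by simpa [Order.one_le_iff_ne_zero, hB.analyticOrderAt_ne_zero] using hB0)
    obtain ⟨k, hk, -, hGk⟩ := hGmul hl
    refine ⟨fun z ↦ k z * d z, hk.mul hd, ?_⟩
    filter_upwards [hGk, hBd.filter_mono nhdsWithin_le_nhds] with z h₁ h₂
    rw [h₂, ← h₁, smul_eq_mul]
    ring
  obtain ⟨M, hM⟩ : ∃ M, ∀ z, (fun z ↦ G z * G (z + L.ω₁ / 2)) =ᶠ[𝓝[≠] z] fun _ ↦ M := by
    refine L.exists_eventuallyEq_const (fun l hl z ↦ ?_) fun z ↦ ?_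
    · simp only [hGper l hl z, add_right_comm z l, hGper l hl (z + _)]
    · by_cases hz : z ∈ L.lattice
      · exact hcancel hz
      by_cases hz' : z + L.ω₁ / 2 ∈ L.lattice
      · obtain ⟨g, hg, hPg⟩ := hcancel hz'
        have ht : Tendsto (fun w ↦ w + L.ω₁ / 2) (𝓝[≠] z) (𝓝[≠] (z + L.ω₁ / 2)) :=
          ((continuous_add_const _).tendsto z).inf
            (tendsto_principal_principal.mpr fun w hw ↦ by simpa using hw)
        refine ⟨fun w ↦ g (w + L.ω₁ / 2), hg.fun_comp_of_eq (by fun_prop) rfl, ?_⟩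
        filter_upwards [ht.eventually hPg] with w hw
        rw [← hw, hPper, mul_comm]
      · exact ⟨_, (hGan z hz).mul ((hGan _ hz').fun_comp_of_eq (f := fun w ↦ w + L.ω₁ / 2)
          (by fun_prop) rfl), .rfl⟩
  have hM0 : M = 0 := by
    have hcont : ContinuousAt (fun z ↦ G z * G (z + L.ω₁ / 2)) (L.ω₂ / 2) :=
      (hGan _ L.ω₂_div_two_notMem_lattice).continuousAt.mul
        (ContinuousAt.comp' (hGan _ (by
          rw [add_comm]; exact L.add_div_two_notMem_lattice)).continuousAt (by fun_prop))
    have := tendsto_nhds_unique_of_eventuallyEq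
      (hcont.tendsto.mono_left nhdsWithin_le_nhds) tendsto_const_nhds (hM (L.ω₂ / 2))
    simpa [hG₂] using this.symm
  -- so `G` vanishes near `ω₁ / 2`, contradicting the identity theorem
  obtain ⟨k, hk, hk0, hGk⟩ := hGmul L.lattice.zero_mem
  have hGne : ∀ᶠ z in 𝓝[≠] (0 : ℂ), G z ≠ 0 := by
    have hkne : ∀ᶠ z in 𝓝 (0 : ℂ), k z ≠ 0 := hk.continuousAt.eventually_ne (hk0 ▸ hc)
    filter_upwards [hGk, hkne.filter_mono nhdsWithin_le_nhds] with z h₁ h₂ h₃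
    exact h₂ (by rw [← h₁, h₃, mul_zero])
  have hmer (z : ℂ) : MeromorphicAt G z := by
    by_cases hz : z ∈ L.lattice
    · obtain ⟨k, hk, -, hGk⟩ := hGmul hz
      refine (hk.meromorphicAt.fun_div (g := fun w ↦ w - z) (by fun_prop)).congr ?_
      filter_upwards [hGk, self_mem_nhdsWithin] with w hw hne
      rw [← hw, mul_div_cancel_left₀ _ (sub_ne_zero.mpr hne)]
    · exact (hGan z hz).meromorphicAt
  have hmerOn : MeromorphicOn G Set.univ := fun z _ ↦ hmer z
  refine hmerOn.meromorphicOrderAt_ne_top_of_isPreconnected (y := L.ω₁ / 2) isPreconnected_univ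
    (Set.mem_univ 0) (Set.mem_univ _)
    ((meromorphicOrderAt_ne_top_iff_eventually_ne_zero (hmer 0)).mpr hGne) ?_
  rw [meromorphicOrderAt_eq_top_iff]
  have ht : Tendsto (fun w ↦ w - L.ω₁ / 2) (𝓝[≠] (L.ω₁ / 2)) (𝓝[≠] 0) :=
    ((continuous_sub_right _).tendsto' _ 0 (sub_self _)).inf
      (tendsto_principal_principal.mpr fun w hw ↦ by simpa [sub_eq_zero] using hw)
  filter_upwards [ht.eventually (hM 0), ht.eventually hGne] with z h₁ h₂
  simpa [hM0, h₂] using h₁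

end PeriodPair

theorem no_elliptic_function_of_degree_one (w₁ w₂ : ℂ) (hw₁ : w₁ ≠ 0) (hw₂ : w₂ ≠ 0)
    (hratio : w₁ / w₂ ∉ Set.range ((↑) : ℝ → ℂ)) :
    ¬ ∃ F : ℂ → ℂ,
        (∀ z : ℂ, F (z + w₁) = F z ∧ F (z + w₂) = F z) ∧
        (∀ z : ℂ, z ∉ latticeSet w₁ w₂ → DifferentiableAt ℂ F z) ∧
        (∃ c : ℂ, c ≠ 0 ∧ ∃ h : ℂ → ℂ, ∃ U : Set ℂ, IsOpen U ∧ (0 : ℂ) ∈ U ∧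
          DifferentiableOn ℂ h U ∧ ∀ z ∈ U, z ≠ 0 → F z = c / z + h z) := by
  rintro ⟨F, hper, hdiff, c, hc, h, U, hU, h0U, hh, hpole⟩
  have hindep : LinearIndependent ℝ ![w₁, w₂] := by
    refine linearIndependent_fin2.mpr ⟨hw₂, fun a ha ↦ hratio ⟨a, ?_⟩⟩
    rw [eq_div_iff hw₂]
    simpa using ha
  let L : PeriodPair := ⟨w₁, w₂, hindep⟩
  have hmem (z : ℂ) : z ∈ latticeSet w₁ w₂ ↔ z ∈ L.lattice := by
    simp [latticeSet, PeriodPair.mem_lattice, L, eq_comm]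
  refine L.false_of_simple_pole (F := F) (fun l hl ↦ L.periodic_of_mem_lattice
    (fun z ↦ (hper z).1) (fun z ↦ (hper z).2) hl) (fun z hz ↦ ?_) hc
    (hh.analyticAt (hU.mem_nhds h0U)) ?_
  · refine DifferentiableOn.analyticAt (s := (L.lattice : Set ℂ)ᶜ) (fun w hw ↦ ?_)
      (L.isClosed_lattice.isOpen_compl.mem_nhds hz)
    exact (hdiff w (by rwa [hmem])).differentiableWithinAt
  · filter_upwards [nhdsWithin_le_nhds (hU.mem_nhds h0U), self_mem_nhdsWithin] with z hz hne
    exact hpole z hz hne
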